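/- arXiv:1911.07212 — 4 statements merged into one kernel-verified Lean document; each statement's English description precedes it below -/
import Mathlib

section
/- The additive code C_4^10 over GF(4) has exactly 2^12 = 4096 elements; equivalently, the twelve generating vectors r1, …, r12 are linearly independent over GF(2), so C_4^10 is a 12-dimensional GF(2)-subspace of GF(4)^10. -/
open Matrix
open scoped Classical

noncomputable section

abbrev F4 := GaloisField 2 2
abbrev F2 := ZMod 2

/-- Hamming weight: number of nonzero coordinates. -/
def wt {n : ℕ} {α : Type*} [Zero α] (v : Fin n → α) : ℕ :=
  Nat.card {i : Fin n // v i ≠ 0}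

def r1 (ω : F4) : Fin 10 → F4 := ![1, 0, 0, 0, 0, 0, ω, 0, ω, ω + 1]
def r2 (ω : F4) : Fin 10 → F4 := ![ω, 0, 0, 0, 0, 0, ω + 1, 0, ω + 1, 1]
def r3 (ω : F4) : Fin 10 → F4 := ![0, 1, 0, 0, 0, 0, ω + 1, 1, 1, 1]
def r4 (ω : F4) : Fin 10 → F4 := ![0, ω, 0, 0, 0, 0, 1, ω, ω, ω]
def r5 (ω : F4) : Fin 10 → F4 := ![0, 0, 1, 0, 0, 0, 1, ω, ω + 1, 0]
def r6 (ω : F4) : Fin 10 → F4 := ![0, 0, ω, 0, 0, 0, ω, ω + 1, 1, 0]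
def r7 (ω : F4) : Fin 10 → F4 := ![0, 0, 0, 1, 0, 0, 0, 1, ω, ω + 1]
def r8 (ω : F4) : Fin 10 → F4 := ![0, 0, 0, ω, 0, 0, 0, ω, ω + 1, 1]
def r9 (ω : F4) : Fin 10 → F4 := ![0, 0, 0, 0, 1, 0, ω + 1, ω + 1, 0, 1]
def r10 (ω : F4) : Fin 10 → F4 := ![0, 0, 0, 0, ω, 0, 1, 1, 0, ω]
def r11 (ω : F4) : Fin 10 → F4 := ![0, 0, 0, 0, 0, 1, 1, ω, 1, 1]
def r12 (ω : F4) : Fin 10 → F4 := ![0, 0, 0, 0, 0, ω, ω, ω + 1, ω, ω]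

/-- The additive code C₄¹⁰: the GF(2)-linear span of r1, …, r12 in GF(4)¹⁰. -/
def C410 (ω : F4) : Submodule F2 (Fin 10 → F4) :=
  Submodule.span F2 (Set.range ![r1 ω, r2 ω, r3 ω, r4 ω, r5 ω, r6 ω, r7 ω, r8 ω, r9 ω, r10 ω, r11 ω, r12 ω])

/-- A root of `X ^ 2 - X - 1` is linearly independent from `1` over the prime field. -/
theorem smul_one_add_smul_eq_zero {ω : F4} (hω : ω ^ 2 = ω + 1) {a b : F2}
    (h : a • (1 : F4) + b • ω = 0) : a = 0 ∧ b = 0 := by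
  have h0 : ω ≠ 0 := by
    rintro rfl
    simp at hω
  have h1 : 1 + ω ≠ 0 := by
    intro h1
    rw [add_comm] at h1
    rw [h1] at hω
    exact h0 (pow_eq_zero_iff two_ne_zero |>.mp hω)
  have key : ∀ x : F2, x = 0 ∨ x = 1 := by decide
  rcases key a with rfl | rfl <;> rcases key b with rfl | rfl <;> simp_all

theorem linearIndependent_rows {ω : F4} (hω : ω ^ 2 = ω + 1) :
    LinearIndependent F2 ![r1 ω, r2 ω, r3 ω, r4 ω, r5 ω, r6 ω, r7 ω, r8 ω, r9 ω, r10 ω,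
      r11 ω, r12 ω] := by
  rw [Fintype.linearIndependent_iff]
  intro g hg
  have h0 := congrFun hg 0
  have h1 := congrFun hg 1
  have h2 := congrFun hg 2
  have h3 := congrFun hg 3
  have h4 := congrFun hg 4
  have h5 := congrFun hg 5
  clear hg
  simp [Fin.sum_univ_succ, r1, r2, r3, r4, r5, r6, r7, r8, r9, r10, r11, r12]
    at h0 h1 h2 h3 h4 h5
  obtain ⟨a0, b0⟩ := smul_one_add_smul_eq_zero hω h0
  obtain ⟨a1, b1⟩ := smul_one_add_smul_eq_zero hω h1
  obtain ⟨a2, b2⟩ := smul_one_add_smul_eq_zero hω h2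
  obtain ⟨a3, b3⟩ := smul_one_add_smul_eq_zero hω h3
  obtain ⟨a4, b4⟩ := smul_one_add_smul_eq_zero hω h4
  obtain ⟨a5, b5⟩ := smul_one_add_smul_eq_zero hω h5
  intro i
  fin_cases i <;> assumption

theorem stmt4 (ω : F4) (hω : ω ^ 2 = ω + 1) :
    Nat.card (C410 ω) = 4096 ∧
    LinearIndependent F2 ![r1 ω, r2 ω, r3 ω, r4 ω, r5 ω, r6 ω, r7 ω, r8 ω, r9 ω, r10 ω, r11 ω, r12 ω] ∧
    Module.finrank F2 (C410 ω) = 12 := by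
  have hli := linearIndependent_rows hω
  have hfr : Module.finrank F2 (C410 ω) = 12 := by
    exact (finrank_span_eq_card hli).trans (Fintype.card_fin 12)
  refine ⟨?_, hli, hfr⟩
  rw [Module.natCard_eq_pow_finrank (K := F2), hfr, Nat.card_zmod]
  norm_num
end
end

section
/- Every nonzero element of the additive code C_4^10 has Hamming weight (number of nonzero coordinates) at least 4, and some element of C_4^10 has Hamming weight exactly 4; that is, the minimum distance of C_4^10 is 4. -/
open Matrix
open scoped Classical

noncomputable section

/-- The element `a + b ω` of `GF(4)` for bits `a` and `b`. -/
def ofBits (ω : F4) (a b : Bool) : F4 :=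
  (if a then 1 else 0) + if b then ω else 0

lemma ofBits_xor (ω : F4) (a b c d : Bool) :
    ofBits ω (a ^^ c) (b ^^ d) = ofBits ω a b + ofBits ω c d := by
  cases a <;> cases b <;> cases c <;> cases d <;>
    simp [ofBits, add_comm, add_left_comm, CharTwo.add_self_eq_zero,
      CharTwo.add_cancel_left]

lemma ofBits_eq_zero_iff {ω : F4} (hω : ω ^ 2 = ω + 1) (a b : Bool) :
    ofBits ω a b = 0 ↔ (a || b) = false := by
  have h0 : ω ≠ 0 := by
    rintro rfl
    simp at hω
  have h1 : 1 + ω ≠ 0 := by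
    intro h
    rw [add_comm ω, h, sq_eq_zero_iff] at hω
    exact h0 hω
  cases a <;> cases b <;> simp [ofBits, h0, h1]

/-- The word over `GF(4)` whose `j`-th entry is `a + b ω`, where `a` and `b` are the bits of `n` at
positions `j` and `j + 10`. -/
def decodeWord (ω : F4) (n : ℕ) (j : Fin 10) : F4 :=
  ofBits ω (n.testBit j) (n.testBit (j + 10))

lemma decodeWord_zero (ω : F4) : decodeWord ω 0 = 0 := by
  funext j
  simp [decodeWord, ofBits]

lemma decodeWord_xor (ω : F4) (m n : ℕ) :
    decodeWord ω (m ^^^ n) = decodeWord ω m + decodeWord ω n := by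
  funext j
  simp only [decodeWord, Nat.testBit_xor, ofBits_xor, Pi.add_apply]

/-- The number of nonzero entries of the word encoded by `n`. -/
def bitWeight (n : ℕ) : ℕ :=
  Nat.count (fun j => (n.testBit j || n.testBit (j + 10)) = true) 10

lemma wt_decodeWord {ω : F4} (hω : ω ^ 2 = ω + 1) (n : ℕ) :
    wt (decodeWord ω n) = bitWeight n := by
  rw [wt, bitWeight, Nat.count_eq_card_filter_range,
    ← Nat.subtype_card (p := fun k => k < 10 ∧ (n.testBit k || n.testBit (k + 10)) = true) _
      (by simp)]
  refine Nat.card_congr ⟨fun i => ⟨i.1, i.1.2, ?_⟩, fun k => ⟨⟨k.1, k.2.1⟩, ?_⟩,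
    fun _ => rfl, fun _ => rfl⟩
  · simpa only [decodeWord, Ne, ofBits_eq_zero_iff hω, Bool.not_eq_false] using i.2
  · simpa only [decodeWord, Ne, ofBits_eq_zero_iff hω, Bool.not_eq_false] using k.2.2

/-- All bitwise sums of sublists of a list of natural numbers. -/
def xorSpan : List ℕ → List ℕ
  | [] => [0]
  | g :: l => xorSpan l ++ (xorSpan l).map (g ^^^ ·)

/-- Whether `p` holds at `n ^^^ m` for all `n` in `xorSpan l`, by recursion on `l`. -/
def allXorSpan (p : ℕ → Bool) : List ℕ → ℕ → Bool
  | [], m => p m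
  | g :: l, m => allXorSpan p l m && allXorSpan p l (g ^^^ m)

lemma apply_xor_of_allXorSpan {p : ℕ → Bool} {l : List ℕ} {m n : ℕ}
    (h : allXorSpan p l m = true) (hn : n ∈ xorSpan l) : p (n ^^^ m) = true := by
  induction l generalizing m n with
  | nil =>
    obtain rfl : n = 0 := by simpa [xorSpan] using hn
    simpa [allXorSpan] using h
  | cons g l ih =>
    simp only [allXorSpan, Bool.and_eq_true] at h
    simp only [xorSpan, List.mem_append, List.mem_map] at hn
    obtain hn | ⟨n, hn, rfl⟩ := hn
    · exact ih h.1 hn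
    · rw [Nat.xor_comm g, Nat.xor_assoc]
      exact ih h.2 hn

lemma mem_span_decodeWord_iff (ω : F4) (l : List ℕ) (v : Fin 10 → F4) :
    v ∈ Submodule.span F2 (decodeWord ω '' {n | n ∈ l}) ↔
      ∃ n ∈ xorSpan l, decodeWord ω n = v := by
  induction l generalizing v with
  | nil => simp [xorSpan, decodeWord_zero, eq_comm]
  | cons g l ih =>
    have hset : {n | n ∈ g :: l} = insert g {n | n ∈ l} := by
      ext n
      simp
    have zero_or_one : ∀ x : F2, x = 0 ∨ x = 1 := by decide
    simp only [hset, Set.image_insert_eq, Submodule.mem_span_insert, ih, xorSpan, List.mem_append,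
      List.mem_map]
    constructor
    · rintro ⟨a, _, ⟨n, hn, rfl⟩, rfl⟩
      rcases zero_or_one a with rfl | rfl
      · exact ⟨n, Or.inl hn, by simp⟩
      · exact ⟨g ^^^ n, Or.inr ⟨n, hn, rfl⟩, by rw [decodeWord_xor, one_smul]⟩
    · rintro ⟨_, hn | ⟨n, hn, rfl⟩, rfl⟩
      · exact ⟨0, _, ⟨_, hn, rfl⟩, by simp⟩
      · exact ⟨1, _, ⟨n, hn, rfl⟩, by rw [decodeWord_xor, one_smul]⟩

/-- The bit encodings of `r1, …, r12`. -/
def generatorBits : List ℕ :=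
  [852481, 329536, 66498, 919616, 393540, 201088,
    787080, 402176, 197328, 540864, 131936, 1015936]

lemma C410_eq_span (ω : F4) :
    C410 ω = Submodule.span F2 (decodeWord ω '' {n | n ∈ generatorBits}) := by
  have hget : ![r1 ω, r2 ω, r3 ω, r4 ω, r5 ω, r6 ω, r7 ω, r8 ω, r9 ω, r10 ω, r11 ω, r12 ω] =
      fun i : Fin 12 => decodeWord ω (generatorBits.get i) := by
    ext i j
    fin_cases i <;> fin_cases j <;>
      simp [generatorBits, decodeWord, ofBits, r1, r2, r3, r4, r5, r6, r7, r8, r9, r10, r11, r12,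
        Nat.testBit, add_comm]
  have hrange := (Set.range_comp (decodeWord ω) generatorBits.get).trans
    (congrArg _ (Set.range_list_get generatorBits))
  exact congrArg (Submodule.span F2) ((congrArg Set.range hget).trans hrange)

lemma four_le_bitWeight : ∀ n ∈ xorSpan generatorBits, n = 0 ∨ 4 ≤ bitWeight n := by
  intro n hn
  have hall : allXorSpan (fun n => n == 0 || Nat.ble 4 (bitWeight n)) generatorBits 0 = true := by
    decide +kernel
  simpa using apply_xor_of_allXorSpan hall hn

theorem stmt5 (ω : F4) (hω : ω ^ 2 = ω + 1) :
    (∀ v ∈ C410 ω, v ≠ 0 → 4 ≤ wt v) ∧ (∃ v ∈ C410 ω, wt v = 4) := by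
  simp only [C410_eq_span, mem_span_decodeWord_iff]
  constructor
  · rintro _ ⟨n, hn, rfl⟩ hv
    rw [wt_decodeWord hω]
    refine (four_le_bitWeight n hn).resolve_left ?_
    rintro rfl
    exact hv (decodeWord_zero ω)
  · refine ⟨_, ⟨265235, ?_, rfl⟩, ?_⟩
    · decide +kernel
    · rw [wt_decodeWord hω]
      decide +kernel
end
end

section
/- The binary code C_O^40 is an optimal [40,22,8] linear code: the 22 listed generating vectors are linearly independent over GF(2) (so C_O^40 has dimension 22 as a GF(2)-subspace of GF(2)^40), every nonzero element of C_O^40 has Hamming weight at least 8, and some element has Hamming weight exactly 8. -/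
open Matrix
open scoped Classical

noncomputable section

/-- φ : GF(4) → GF(2)⁴ with φ(0)=0000, φ(1)=0011, φ(ω)=0101, φ(ω̄)=0110. -/
def phi (ω : F4) (x : F4) : Fin 4 → F2 :=
  if x = 0 then ![0, 0, 0, 0]
  else if x = 1 then ![0, 0, 1, 1]
  else if x = ω then ![0, 1, 0, 1]
  else ![0, 1, 1, 0]

/-- Φ applies φ to each coordinate and concatenates. -/
def Phi (ω : F4) (v : Fin 10 → F4) : Fin 40 → F2 := fun j =>
  phi ω (v ⟨j.val / 4, by have := j.isLt; omega⟩) ⟨j.val % 4, by omega⟩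

/-- u i (for i = 0, …, 8, corresponding to u_(i+1)) has ones exactly in the eight
positions 4(i+1)-3, …, 4(i+1)+4 (1-indexed). -/
def u (i : Fin 9) : Fin 40 → F2 := fun j =>
  if 4 * i.val ≤ j.val ∧ j.val < 4 * i.val + 8 then 1 else 0

/-- (1,0,0,0) repeated 10 times. -/
def d1 : Fin 40 → F2 := fun j => if j.val % 4 = 0 then 1 else 0

/-- (1,0,0,0) repeated 9 times followed by (0,1,1,1). -/
def d2 : Fin 40 → F2 := fun j =>
  if j.val < 36 then (if j.val % 4 = 0 then 1 else 0)
  else (if j.val % 4 = 0 then 0 else 1)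

def gensO40 (ω : F4) : Fin 22 → Fin 40 → F2 :=
  ![Phi ω (r1 ω), Phi ω (r2 ω), Phi ω (r3 ω), Phi ω (r4 ω), Phi ω (r5 ω), Phi ω (r6 ω),
    Phi ω (r7 ω), Phi ω (r8 ω), Phi ω (r9 ω), Phi ω (r10 ω), Phi ω (r11 ω), Phi ω (r12 ω),
    u 0, u 1, u 2, u 3, u 4, u 5, u 6, u 7, u 8, d2]

def CO40 (ω : F4) : Submodule F2 (Fin 40 → F2) :=
  Submodule.span F2 (Set.range (gensO40 ω))

/-- The generators `r1, …, r12`, with `p ω + q` in GF(4) written as the pair `(p, q)`. -/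
def symbolGen : Fin 12 → Fin 10 → F2 × F2 :=
  let o : F2 × F2 := (0, 0)
  let e : F2 × F2 := (0, 1)
  let w : F2 × F2 := (1, 0)
  let v : F2 × F2 := (1, 1)
  ![![e, o, o, o, o, o, w, o, w, v],
    ![w, o, o, o, o, o, v, o, v, e],
    ![o, e, o, o, o, o, v, e, e, e],
    ![o, w, o, o, o, o, e, w, w, w],
    ![o, o, e, o, o, o, e, w, v, o],
    ![o, o, w, o, o, o, w, v, e, o],
    ![o, o, o, e, o, o, o, e, w, v],
    ![o, o, o, w, o, o, o, w, v, e],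
    ![o, o, o, o, e, o, v, v, o, e],
    ![o, o, o, o, w, o, e, e, o, w],
    ![o, o, o, o, o, e, e, w, e, e],
    ![o, o, o, o, o, w, w, v, w, w]]

/-- The entry of `u b` in the `i`-th block of length 4. -/
def blockU (b : Fin 9) (i : Fin 10) : F2 :=
  if b.castSucc = i ∨ b.succ = i then 1 else 0

/-- The entry of `d2` at position `k` of the `i`-th block of length 4. -/
def blockD (i : Fin 10) (k : Fin 4) : F2 :=
  if i = 9 then (if k = 0 then 0 else 1) else (if k = 0 then 1 else 0)

/-- The image under `phi` of the element `p ω + q` of GF(4), for `x = (p, q)`. -/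
def encode (x : F2 × F2) : Fin 4 → F2 := ![0, x.1, x.2, x.1 + x.2]

theorem omega_ne_zero {ω : F4} (hω : ω ^ 2 = ω + 1) : ω ≠ 0 := by
  rintro rfl
  simp at hω

theorem omega_ne_one {ω : F4} (hω : ω ^ 2 = ω + 1) : ω ≠ 1 := by
  rintro rfl
  simp at hω

theorem omega_add_one_ne_zero {ω : F4} (hω : ω ^ 2 = ω + 1) : ω + 1 ≠ 0 := by
  rw [← hω]
  exact pow_ne_zero 2 (omega_ne_zero hω)

@[simp]
theorem phi_zero (ω : F4) : phi ω 0 = ![0, 0, 0, 0] := by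
  simp [phi]

@[simp]
theorem phi_one (ω : F4) : phi ω 1 = ![0, 0, 1, 1] := by
  simp [phi]

theorem phi_omega {ω : F4} (hω : ω ^ 2 = ω + 1) : phi ω ω = ![0, 1, 0, 1] := by
  simp [phi, omega_ne_zero hω, omega_ne_one hω]

theorem phi_omega_add_one {ω : F4} (hω : ω ^ 2 = ω + 1) : phi ω (ω + 1) = ![0, 1, 1, 0] := by
  simp [phi, omega_ne_zero hω, omega_add_one_ne_zero hω]

theorem Phi_finProdFinEquiv (ω : F4) (v : Fin 10 → F4) (i : Fin 10) (k : Fin 4) :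
    Phi ω v (finProdFinEquiv (i, k)) = phi ω (v i) k := by
  have hi : (⟨(finProdFinEquiv (i, k)).val / 4, by omega⟩ : Fin 10) = i := by
    ext
    simp only [finProdFinEquiv_apply_val]
    omega
  have hk : (⟨(finProdFinEquiv (i, k)).val % 4, by omega⟩ : Fin 4) = k := by
    ext
    simp only [finProdFinEquiv_apply_val]
    omega
  unfold Phi
  rw [hi, hk]

theorem gensO40_symbol {ω : F4} (hω : ω ^ 2 = ω + 1) (j : Fin 12) (i : Fin 10) (k : Fin 4) :
    gensO40 ω (Fin.castAdd 10 j) (finProdFinEquiv (i, k)) = encode (symbolGen j i) k := by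
  fin_cases j <;> refine (Phi_finProdFinEquiv ω _ i k).trans (congrFun ?_ k) <;> fin_cases i <;>
    simp [r1, r2, r3, r4, r5, r6, r7, r8, r9, r10, r11, r12, symbolGen, encode, phi_omega hω,
      phi_omega_add_one hω] <;> rfl

theorem gensO40_u (ω : F4) (b : Fin 9) (i : Fin 10) (k : Fin 4) :
    gensO40 ω (Fin.natAdd 12 b.castSucc) (finProdFinEquiv (i, k)) = blockU b i := by
  have h : gensO40 ω (Fin.natAdd 12 b.castSucc) = u b := by
    fin_cases b <;> rfl
  rw [h]
  clear h
  revert b i k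
  unfold u blockU
  decide

theorem gensO40_d2 (ω : F4) (i : Fin 10) (k : Fin 4) :
    gensO40 ω (Fin.natAdd 12 (Fin.last 9)) (finProdFinEquiv (i, k)) = blockD i k := by
  change d2 _ = _
  revert i k
  unfold d2 blockD
  decide

theorem sum_smul_gensO40_apply {ω : F4} (hω : ω ^ 2 = ω + 1) (c : Fin (12 + 10) → F2)
    (i : Fin 10) (k : Fin 4) :
    (∑ j, c j • gensO40 ω j) (finProdFinEquiv (i, k)) =
      encode (∑ j, c (Fin.castAdd 10 j) • symbolGen j i) k +
        (∑ b : Fin 9, c (Fin.natAdd 12 b.castSucc) * blockU b i +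
          c (Fin.natAdd 12 (Fin.last 9)) * blockD i k) := by
  rw [Fin.sum_univ_add, Fin.sum_univ_castSucc (n := 9)]
  simp only [Pi.add_apply, Finset.sum_apply, Pi.smul_apply, smul_eq_mul, gensO40_symbol hω,
    gensO40_u, gensO40_d2]
  congr 1
  fin_cases k <;>
    simp [encode, Prod.fst_sum, Prod.snd_sum, mul_add, Finset.sum_add_distrib]

/-- The Hamming weight is the sum of the Hamming weights of the blocks of length 4. -/
theorem wt_eq_sum_blocks (v : Fin 40 → F2) :
    wt v = ∑ i : Fin 10, wt fun k : Fin 4 => v (finProdFinEquiv (i, k)) := by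
  simp only [wt, Nat.card_eq_fintype_card, Fintype.card_subtype, Finset.card_filter]
  exact ((finProdFinEquiv (m := 10) (n := 4)).sum_comp _).symm.trans (Fintype.sum_prod_type _)

/-- Whether an element of GF(2) is nonzero. -/
def bit (x : F2) : Bool := x.val != 0

theorem bit_zero : bit 0 = false := by decide

theorem bit_add : ∀ x y : F2, bit (x + y) = (bit x ^^ bit y) := by decide

theorem bit_eq_false : ∀ x : F2, bit x = false ↔ x = 0 := by decide

/-- `four_le_symbol_weight`, spelled out coordinate by coordinate. -/
theorem xor_encoding_weight (a b c d e f g h i j k l : Bool) :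
    (a || b || c || d || e || f || g || h || i || j || k || l) = false ∨ 4 ≤
      (b || a).toNat +
      (d || c).toNat +
      (f || e).toNat +
      (h || g).toNat +
      (j || i).toNat +
      (l || k).toNat +
      ((a ^^ b ^^ c ^^ f ^^ i ^^ l) || (b ^^ c ^^ d ^^ e ^^ i ^^ j ^^ k)).toNat +
      ((d ^^ e ^^ f ^^ h ^^ i ^^ k ^^ l) || (c ^^ f ^^ g ^^ i ^^ j ^^ l)).toNat +
      ((a ^^ b ^^ d ^^ e ^^ g ^^ h ^^ l) || (b ^^ c ^^ e ^^ f ^^ h ^^ k)).toNat +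
      ((a ^^ d ^^ g ^^ j ^^ l) || (a ^^ b ^^ c ^^ g ^^ h ^^ i ^^ k)).toNat := by
  revert a b c d e f g h i j k l
  decide +kernel

theorem xor_adjacent_weight (a b c d e f g h i : Bool) :
    (a || b || c || d || e || f || g || h || i) = false ∨
      2 ≤ a.toNat + (a ^^ b).toNat + (b ^^ c).toNat + (c ^^ d).toNat + (d ^^ e).toNat +
        (e ^^ f).toNat + (f ^^ g).toNat + (g ^^ h).toNat + (h ^^ i).toNat + i.toNat := by
  revert a b c d e f g h i
  decide +kernel

/-- The code spanned by `symbolGen` has minimum weight at least 4. -/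
theorem four_le_symbol_weight (c : Fin 12 → F2) (hc : c ≠ 0) :
    4 ≤ ∑ i, (bit (∑ j, c j • symbolGen j i).1 || bit (∑ j, c j • symbolGen j i).2).toNat := by
  rcases xor_encoding_weight (bit (c 0)) (bit (c 1)) (bit (c 2)) (bit (c 3)) (bit (c 4))
    (bit (c 5)) (bit (c 6)) (bit (c 7)) (bit (c 8)) (bit (c 9)) (bit (c 10)) (bit (c 11))
    with h | h
  · simp only [Bool.or_eq_false_iff, bit_eq_false] at h
    refine absurd (funext fun j => ?_) hc
    fin_cases j <;> simp [h]
  · simpa [Fin.sum_univ_succ, symbolGen, bit_add, bit_zero, add_assoc] using h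

/-- The code spanned by the `u b` has two nonzero blocks in every nonzero codeword. -/
theorem two_le_blockU_weight (c : Fin 9 → F2) (hc : c ≠ 0) :
    2 ≤ ∑ i, (bit (∑ b, c b * blockU b i)).toNat := by
  rcases xor_adjacent_weight (bit (c 0)) (bit (c 1)) (bit (c 2)) (bit (c 3)) (bit (c 4))
    (bit (c 5)) (bit (c 6)) (bit (c 7)) (bit (c 8)) with h | h
  · simp only [Bool.or_eq_false_iff, bit_eq_false] at h
    refine absurd (funext fun j => ?_) hc
    fin_cases j <;> simp [h]
  · simpa [Fin.sum_univ_succ, blockU, bit_add, bit_zero, add_assoc] using h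

/-- The weight of a vector of length 4 over GF(2), in computable form. -/
theorem wt_four (w : Fin 4 → F2) :
    wt w = (bit (w 0)).toNat + (bit (w 1)).toNat + (bit (w 2)).toNat + (bit (w 3)).toNat := by
  have h (x : F2) : (if x ≠ 0 then 1 else 0) = (bit x).toNat := by
    revert x
    decide
  simp only [wt, Nat.card_eq_fintype_card, Fintype.card_subtype, Finset.card_filter, h,
    Fin.sum_univ_four]

theorem one_le_wt_of_sum_ne_zero (w : Fin 4 → F2) (hw : w 0 + w 1 + w 2 + w 3 ≠ 0) :
    1 ≤ wt w := by
  rw [wt_four]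
  generalize w 0 = a, w 1 = b, w 2 = c, w 3 = d at *
  revert a b c d
  decide

theorem two_mul_symbol_weight_le_wt (w : Fin 4 → F2) (hw : w 0 + w 1 + w 2 + w 3 = 0) :
    2 * (bit (w 0 + w 1) || bit (w 0 + w 2)).toNat ≤ wt w := by
  rw [wt_four]
  generalize w 0 = a, w 1 = b, w 2 = c, w 3 = d at *
  revert a b c d
  decide

theorem eight_le_wt_of_ne_zero {ω : F4} (hω : ω ^ 2 = ω + 1) (c : Fin (12 + 10) → F2)
    (hc : c ≠ 0) : 8 ≤ wt (∑ j, c j • gensO40 ω j) := by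
  rw [wt_eq_sum_blocks]
  simp only [sum_smul_gensO40_apply hω]
  generalize hs : c (Fin.natAdd 12 (Fin.last 9)) = s
  by_cases hs0 : s = 0
  · simp only [hs0, zero_mul, add_zero]
    by_cases hx : (fun j => c (Fin.castAdd 10 j)) = 0
    · have hy : (fun b : Fin 9 => c (Fin.natAdd 12 b.castSucc)) ≠ 0 := by
        intro hy
        refine hc (funext fun j => ?_)
        exact Fin.addCases (congrFun hx) (Fin.lastCases (hs.trans hs0) (congrFun hy)) j
      have hx' (j : Fin 12) : c (Fin.castAdd 10 j) = 0 := congrFun hx j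
      calc 8 ≤ 4 * _ := Nat.mul_le_mul_left 4 (two_le_blockU_weight _ hy)
        _ = _ := by
          rw [Finset.mul_sum]
          refine Finset.sum_congr rfl fun i _ => ?_
          simp only [hx', zero_smul, Finset.sum_const_zero, wt_four]
          simp [encode]
          ring
    · calc 8 ≤ 2 * _ := Nat.mul_le_mul_left 2 (four_le_symbol_weight _ hx)
        _ ≤ _ := by
          rw [Finset.mul_sum]
          refine Finset.sum_le_sum fun i _ => ?_
          generalize ∑ b : Fin 9, c (Fin.natAdd 12 b.castSucc) * blockU b i = t
          generalize ∑ j, c (Fin.castAdd 10 j) • symbolGen j i = x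
          refine le_trans (le_of_eq ?_) (two_mul_symbol_weight_le_wt _ ?_)
          all_goals
            revert t x
            unfold encode
            decide
  · calc 8 ≤ ∑ i : Fin 10, 1 := by simp
      _ ≤ _ := by
        refine Finset.sum_le_sum fun i _ => one_le_wt_of_sum_ne_zero _ ?_
        generalize ∑ b : Fin 9, c (Fin.natAdd 12 b.castSucc) * blockU b i = t
        generalize ∑ j, c (Fin.castAdd 10 j) • symbolGen j i = x
        clear hs
        revert s t x i
        unfold encode blockD
        decide

theorem stmt11 (ω : F4) (hω : ω ^ 2 = ω + 1) :
    LinearIndependent F2 (gensO40 ω) ∧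
    Module.finrank F2 (CO40 ω) = 22 ∧
    (∀ v ∈ CO40 ω, v ≠ 0 → 8 ≤ wt v) ∧ (∃ v ∈ CO40 ω, wt v = 8) := by
  have hmin := eight_le_wt_of_ne_zero hω
  have hli : LinearIndependent F2 (gensO40 ω) := by
    rw [Fintype.linearIndependent_iff]
    intro c hc j
    by_contra hj
    have h := hmin c fun h => hj (congrFun h j)
    rw [hc] at h
    simp [wt] at h
  refine ⟨hli, ?_, ?_, u 0, ?_, ?_⟩
  · rw [CO40, finrank_span_eq_card hli, Fintype.card_fin]
  · intro v hv hv0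
    obtain ⟨c, rfl⟩ := (Submodule.mem_span_range_iff_exists_fun F2).1 hv
    refine hmin c ?_
    rintro rfl
    simp at hv0
  · exact Submodule.subset_span ⟨12, rfl⟩
  · rw [wt_eq_sum_blocks]
    simp only [wt_four]
    unfold u
    decide
end
end

section
/- The binary codes C_O^40 and C_E^40 are inequivalent: there is no permutation σ of the coordinate set {1, …, 40} such that the image of C_O^40 under permuting coordinates by σ equals C_E^40. -/
open Matrix
open scoped Classical

noncomputable section

def gensE40 (ω : F4) : Fin 22 → Fin 40 → F2 :=
  ![Phi ω (r1 ω), Phi ω (r2 ω), Phi ω (r3 ω), Phi ω (r4 ω), Phi ω (r5 ω), Phi ω (r6 ω),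
    Phi ω (r7 ω), Phi ω (r8 ω), Phi ω (r9 ω), Phi ω (r10 ω), Phi ω (r11 ω), Phi ω (r12 ω),
    u 0, u 1, u 2, u 3, u 4, u 5, u 6, u 7, u 8, d1]

def CE40 (ω : F4) : Submodule F2 (Fin 40 → F2) :=
  Submodule.span F2 (Set.range (gensE40 ω))

/-- The elements of `GF(4)` listed as `0, 1, ω, ω + 1`. -/
def elem (ω : F4) : Fin 4 → F4 := ![0, 1, ω, ω + 1]

/-- The values of `phi` on the list `elem ω`. -/
def phiTable : Fin 4 → Fin 4 → F2 :=
  ![![0, 0, 0, 0], ![0, 0, 1, 1], ![0, 1, 0, 1], ![0, 1, 1, 0]]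

/-- The generators `r1, …, r12`, each entry given by its index in the list `elem ω`. -/
def quaternaryIndex : Fin 12 → Fin 10 → Fin 4 :=
  ![![1, 0, 0, 0, 0, 0, 2, 0, 2, 3],
    ![2, 0, 0, 0, 0, 0, 3, 0, 3, 1],
    ![0, 1, 0, 0, 0, 0, 3, 1, 1, 1],
    ![0, 2, 0, 0, 0, 0, 1, 2, 2, 2],
    ![0, 0, 1, 0, 0, 0, 1, 2, 3, 0],
    ![0, 0, 2, 0, 0, 0, 2, 3, 1, 0],
    ![0, 0, 0, 1, 0, 0, 0, 1, 2, 3],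
    ![0, 0, 0, 2, 0, 0, 0, 2, 3, 1],
    ![0, 0, 0, 0, 1, 0, 3, 3, 0, 1],
    ![0, 0, 0, 0, 2, 0, 1, 1, 0, 2],
    ![0, 0, 0, 0, 0, 1, 1, 2, 1, 1],
    ![0, 0, 0, 0, 0, 2, 2, 3, 2, 2]]

/-- The binary images `Φ(r1), …, Φ(r12)` as the rows of an explicit matrix. -/
def phiRows : Matrix (Fin 12) (Fin 40) F2 := of fun i j =>
  phiTable (quaternaryIndex i ⟨j.val / 4, by have := j.isLt; omega⟩) ⟨j.val % 4, by omega⟩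

/-- The generators `u 0, …, u 8` followed by one more vector `d`. -/
def hullRows (d : Fin 40 → F2) : Fin 10 → Fin 40 → F2 :=
  ![u 0, u 1, u 2, u 3, u 4, u 5, u 6, u 7, u 8, d]

/-- The inverse of the Gram matrix of `Φ(r1), …, Φ(r12)`. -/
def gramInv : Matrix (Fin 12) (Fin 12) F2 :=
  !![0, 1, 0, 1, 1, 0, 0, 1, 1, 1, 1, 0;
     1, 0, 1, 0, 1, 1, 1, 0, 0, 1, 1, 1;
     0, 1, 0, 0, 1, 1, 1, 1, 1, 0, 0, 1;
     1, 0, 0, 0, 0, 1, 0, 1, 1, 1, 1, 0;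
     1, 1, 1, 0, 0, 1, 0, 0, 0, 1, 1, 1;
     0, 1, 1, 1, 1, 0, 0, 0, 1, 0, 0, 1;
     0, 1, 1, 0, 0, 0, 0, 1, 1, 1, 0, 1;
     1, 0, 1, 1, 0, 0, 1, 0, 0, 1, 1, 0;
     1, 0, 1, 1, 0, 1, 1, 0, 0, 0, 0, 0;
     1, 1, 0, 1, 1, 0, 1, 1, 0, 0, 0, 0;
     1, 1, 0, 1, 1, 0, 0, 1, 0, 0, 0, 0;
     0, 1, 1, 0, 1, 1, 1, 0, 0, 0, 0, 0]

lemma phi_elem {ω : F4} (hω : ω ^ 2 = ω + 1) (k : Fin 4) : phi ω (elem ω k) = phiTable k := by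
  have h0 : ω ≠ 0 := by rintro rfl; simp at hω
  have h1 : ω ≠ 1 := by rintro rfl; simp at hω
  have h2 : ω + 1 ≠ 0 := by rw [← hω]; exact pow_ne_zero 2 h0
  fin_cases k <;> simp [phi, elem, phiTable, h0, h1, h2]

lemma Phi_elem_comp {ω : F4} (hω : ω ^ 2 = ω + 1) (i : Fin 12) :
    Phi ω (elem ω ∘ quaternaryIndex i) = phiRows i := by
  funext j
  simp [Phi, phiRows, phi_elem hω]

lemma phiRows_eq {ω : F4} (hω : ω ^ 2 = ω + 1) :
    phiRows = ![Phi ω (r1 ω), Phi ω (r2 ω), Phi ω (r3 ω), Phi ω (r4 ω), Phi ω (r5 ω),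
      Phi ω (r6 ω), Phi ω (r7 ω), Phi ω (r8 ω), Phi ω (r9 ω), Phi ω (r10 ω), Phi ω (r11 ω),
      Phi ω (r12 ω)] := by
  funext i
  rw [← Phi_elem_comp hω i]
  fin_cases i <;> refine congrArg (Phi ω) (funext fun j => ?_) <;> fin_cases j <;> rfl

lemma CO40_eq {ω : F4} (hω : ω ^ 2 = ω + 1) :
    CO40 ω = Submodule.span F2 (Set.range phiRows ∪ Set.range (hullRows d2)) := by
  rw [CO40, phiRows_eq hω]
  congr 1
  simp [gensO40, hullRows]

lemma CE40_eq {ω : F4} (hω : ω ^ 2 = ω + 1) :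
    CE40 ω = Submodule.span F2 (Set.range phiRows ∪ Set.range (hullRows d1)) := by
  rw [CE40, phiRows_eq hω]
  congr 1
  simp [gensE40, hullRows]

lemma gram_mul_gramInv : phiRows * phiRowsᵀ * gramInv = 1 := by
  decide +kernel

lemma phiRows_dotProduct_hullRows_d1 (i : Fin 12) (j : Fin 10) :
    phiRows i ⬝ᵥ hullRows d1 j = 0 := by
  revert i j; decide +kernel

lemma phiRows_dotProduct_hullRows_d2 (i : Fin 12) (j : Fin 10) :
    phiRows i ⬝ᵥ hullRows d2 j = 0 := by
  revert i j; decide +kernel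

lemma hullRows_d1_dotProduct_hullRows_d1 (i j : Fin 10) :
    hullRows d1 i ⬝ᵥ hullRows d1 j = 0 := by
  revert i j; decide +kernel

lemma hullRows_d2_dotProduct_hullRows_d2 (i j : Fin 10) :
    hullRows d2 i ⬝ᵥ hullRows d2 j = 0 := by
  revert i j; decide +kernel

lemma four_dvd_weight_hullRows_d2 (i : Fin 10) : 4 ∣ ∑ k, (hullRows d2 i k).val := by
  revert i; decide +kernel

lemma dotProduct_eq_zero_of_mem_span {R m : Type*} [CommRing R] [Fintype m] {S : Set (m → R)}
    {x y : m → R} (h : ∀ s ∈ S, x ⬝ᵥ s = 0) (hy : y ∈ Submodule.span R S) : x ⬝ᵥ y = 0 := by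
  induction hy using Submodule.span_induction with
  | mem s hs => exact h s hs
  | zero => simp
  | add a b _ _ ha hb => rw [dotProduct_add, ha, hb, add_zero]
  | smul c a _ ha => rw [dotProduct_smul, ha, smul_zero]

/-- The weight of a sum of two binary vectors, by inclusion and exclusion. -/
lemma weight_add {m : Type*} [Fintype m] (x y : m → F2) :
    ∑ k, ((x + y) k).val + 2 * ∑ k, (x k * y k).val = ∑ k, (x k).val + ∑ k, (y k).val := by
  have h : ∀ a b : F2, (a + b).val + 2 * (a * b).val = a.val + b.val := by decide
  simp only [Finset.mul_sum, ← Finset.sum_add_distrib, Pi.add_apply, h]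

lemma two_dvd_of_dotProduct_eq_zero {m : Type*} [Fintype m] {x y : m → F2} (h : x ⬝ᵥ y = 0) :
    2 ∣ ∑ k, (x k * y k).val := by
  rw [← ZMod.natCast_eq_zero_iff, Nat.cast_sum]
  simp only [ZMod.natCast_val, ZMod.cast_id]
  exact h

/-- A binary code generated by pairwise orthogonal vectors of doubly even weight is doubly even. -/
lemma four_dvd_weight_of_mem_span {m : Type*} [Fintype m] {S : Set (m → F2)}
    (horth : ∀ s ∈ S, ∀ t ∈ S, s ⬝ᵥ t = 0) (hS : ∀ s ∈ S, 4 ∣ ∑ k, (s k).val)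
    {x : m → F2} (hx : x ∈ Submodule.span F2 S) : 4 ∣ ∑ k, (x k).val := by
  induction hx using Submodule.span_induction with
  | mem s hs => exact hS s hs
  | zero => simp
  | add a b ha hb iha ihb =>
    have hab : a ⬝ᵥ b = 0 := dotProduct_eq_zero_of_mem_span (fun s hs => by
      rw [dotProduct_comm]
      exact dotProduct_eq_zero_of_mem_span (horth s hs) ha) hb
    have := two_dvd_of_dotProduct_eq_zero hab
    have := weight_add a b
    omega
  | smul c a _ iha =>
    obtain rfl | rfl : c = 0 ∨ c = 1 := by revert c; decide
    · simp
    · simpa using iha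

lemma d1_dotProduct_eq_zero {ω : F4} (hω : ω ^ 2 = ω + 1) {y : Fin 40 → F2}
    (hy : y ∈ CE40 ω) : d1 ⬝ᵥ y = 0 := by
  rw [CE40_eq hω] at hy
  refine dotProduct_eq_zero_of_mem_span ?_ hy
  rintro _ (⟨i, rfl⟩ | ⟨i, rfl⟩)
  · rw [dotProduct_comm]
    exact phiRows_dotProduct_hullRows_d1 i 9
  · exact hullRows_d1_dotProduct_hullRows_d1 9 i

lemma mem_span_hullRows_d2 {ω : F4} (hω : ω ^ 2 = ω + 1) {w : Fin 40 → F2} (hw : w ∈ CO40 ω)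
    (horth : ∀ y ∈ CO40 ω, w ⬝ᵥ y = 0) : w ∈ Submodule.span F2 (Set.range (hullRows d2)) := by
  rw [CO40_eq hω] at hw horth
  rw [Submodule.span_union, Submodule.mem_sup] at hw
  obtain ⟨a, ha, b, hb, rfl⟩ := hw
  obtain ⟨c, rfl⟩ := (Submodule.mem_span_range_iff_exists_fun F2).1 ha
  have hc : ∑ i, c i • phiRows i = c ᵥ* phiRows := (vecMul_eq_sum c phiRows).symm
  rw [hc] at horth ⊢
  have h0 : c ᵥ* (phiRows * phiRowsᵀ) = 0 := by
    rw [← vecMul_vecMul]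
    funext i
    have h := horth (phiRows i) (Submodule.subset_span (Or.inl ⟨i, rfl⟩))
    have hbi : phiRows i ⬝ᵥ b = 0 := dotProduct_eq_zero_of_mem_span (by
      rintro _ ⟨j, rfl⟩
      exact phiRows_dotProduct_hullRows_d2 i j) hb
    rw [add_dotProduct, dotProduct_comm b, hbi, add_zero] at h
    exact h
  have hc0 : c = 0 := by
    rw [← vecMul_one c, ← gram_mul_gramInv, ← vecMul_vecMul, h0, zero_vecMul]
  rwa [hc0, zero_vecMul, zero_add]

theorem stmt13 (ω : F4) (hω : ω ^ 2 = ω + 1) :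
    ¬ ∃ σ : Equiv.Perm (Fin 40),
      (fun v : Fin 40 → F2 => fun i => v (σ i)) '' (CO40 ω : Set (Fin 40 → F2)) =
        (CE40 ω : Set (Fin 40 → F2)) := by
  rintro ⟨σ, hσ⟩
  have hd : d1 ∈ (CE40 ω : Set (Fin 40 → F2)) := Submodule.subset_span ⟨21, rfl⟩
  rw [← hσ] at hd
  obtain ⟨w, hw, hwd⟩ := hd
  have horth : ∀ y ∈ CO40 ω, w ⬝ᵥ y = 0 := fun y hy => by
    have hyE : (fun i => y (σ i)) ∈ (CE40 ω : Set (Fin 40 → F2)) := hσ ▸ ⟨y, hy, rfl⟩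
    have h := d1_dotProduct_eq_zero hω hyE
    rw [← hwd] at h
    exact (Equiv.sum_comp σ fun i => w i * y i).symm.trans h
  have h4 : 4 ∣ ∑ k, (w k).val := by
    refine four_dvd_weight_of_mem_span ?_ ?_ (mem_span_hullRows_d2 hω hw horth)
    · rintro _ ⟨i, rfl⟩ _ ⟨j, rfl⟩
      exact hullRows_d2_dotProduct_hullRows_d2 i j
    · rintro _ ⟨i, rfl⟩
      exact four_dvd_weight_hullRows_d2 i
  rw [← Equiv.sum_comp σ] at h4
  have h10 : ¬ 4 ∣ ∑ k, (d1 k).val := by decide +kernel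
  exact h10 (hwd ▸ h4)
end
end
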